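/- The projections between (orbit) configuration spaces of the 2-sphere onto initial coordinates admit cross-sections in the following cases: (i) for n ≥ k ≥ 3, the projection π_{n,k} : C_n(S²) → C_k(S²) admits a continuous cross-section; (ii) the projection C₂(S²) → S² admits a continuous cross-section; (iii) for n ≥ k ≥ 2, the projection π_{n,k} : C_n^±(S²) → C_k^±(S²) between antipodal orbit configuration spaces admits a continuous cross-section. -/

import Mathlib

/-- The unit 2-sphere in euclidean 3-space. -/
abbrev TwoSphere : Set (EuclideanSpace ℝ (Fin 3)) :=
  Metric.sphere (0 : EuclideanSpace ℝ (Fin 3)) 1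

/-- The ordered configuration space of `n` points of the 2-sphere. -/
abbrev ConfS2 (n : ℕ) : Type :=
  {f : Fin n → ↥TwoSphere // ∀ i j : Fin n, i ≠ j → f i ≠ f j}

/-- The orbit configuration space `C_n^±(S²)` of `n` ordered points of the
2-sphere, pairwise neither equal nor antipodal. -/
abbrev ConfPM (n : ℕ) : Type :=
  {f : Fin n → ↥TwoSphere // ∀ i j : Fin n, i ≠ j → f i ≠ f j ∧ f i ≠ -f j}

/-- The projection `π_{n,k} : C_n(S²) → C_k(S²)` onto the first `k`
coordinates (`k ≤ n`). -/
def projS2 (n k : ℕ) (h : k ≤ n) (q : ConfS2 n) : ConfS2 k :=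
  ⟨fun i => q.val (Fin.castLE h i), fun i j hij =>
    q.2 (Fin.castLE h i) (Fin.castLE h j) fun e => hij (Fin.castLE_injective h e)⟩

/-- The projection `π_{n,k} : C_n^±(S²) → C_k^±(S²)` onto the first `k`
coordinates (`k ≤ n`). -/
def projPM (n k : ℕ) (h : k ≤ n) (q : ConfPM n) : ConfPM k :=
  ⟨fun i => q.val (Fin.castLE h i), fun i j hij =>
    q.2 (Fin.castLE h i) (Fin.castLE h j) fun e => hij (Fin.castLE_injective h e)⟩

lemma aux_bound {X : Type*} [TopologicalSpace X] (k : ℕ) (f : Fin k → X → ℝ)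
    (hf : ∀ i, Continuous (f i)) (h1 : ∀ i x, f i x < 1) :
    ∃ M : X → ℝ, Continuous M ∧ (∀ x, 0 ≤ M x ∧ M x < 1) ∧ ∀ i x, f i x ≤ M x := by
  induction k with
  | zero => exact ⟨fun _ => 0, continuous_const, fun _ => ⟨le_rfl, one_pos⟩, fun i => i.elim0⟩
  | succ k ih =>
    obtain ⟨M, hM, hM1, hM2⟩ := ih (fun i => f i.castSucc) (fun i => hf _) (fun i => h1 _)
    refine ⟨fun x => max (M x) (f (Fin.last k) x), hM.max (hf _), fun x => ⟨?_, ?_⟩, ?_⟩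
    · exact le_max_of_le_left (hM1 x).1
    · exact max_lt (hM1 x).2 (h1 _ x)
    · intro i x
      refine Fin.lastCases ?_ (fun j => ?_) i
      · exact le_max_right _ _
      · exact le_max_of_le_left (hM2 j x)

lemma aux_norm (x : TwoSphere) : ‖(x : EuclideanSpace ℝ (Fin 3))‖ = 1 := by
  simpa using x.2

lemma aux_self (x : TwoSphere) :
    inner ℝ (x : EuclideanSpace ℝ (Fin 3)) (x : EuclideanSpace ℝ (Fin 3)) = 1 := by
  rw [real_inner_self_eq_norm_sq, aux_norm]; norm_num

lemma aux_lt (x y : TwoSphere) (h : x ≠ y) :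
    inner ℝ (x : EuclideanSpace ℝ (Fin 3)) (y : EuclideanSpace ℝ (Fin 3)) < 1 := by
  refine (inner_lt_one_iff_real_of_norm_eq_one (aux_norm x) (aux_norm y)).2 ?_
  exact fun e => h (Subtype.ext e)

lemma aux_new {X : Type*} [TopologicalSpace X] (k : ℕ) (f : Fin k → X → ℝ)
    (hf : ∀ i, Continuous (f i)) (h1 : ∀ i x, f i x < 1)
    (p : X → TwoSphere) (hp : Continuous p) (v : X → EuclideanSpace ℝ (Fin 3))
    (hv : Continuous v) (hv0 : ∀ x, v x ≠ 0)
    (hvp : ∀ x, inner ℝ (v x) (p x : EuclideanSpace ℝ (Fin 3)) = 0) :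
    ∃ q : X → TwoSphere, Continuous q ∧ ∀ x,
      0 ≤ inner ℝ (q x : EuclideanSpace ℝ (Fin 3)) (p x : EuclideanSpace ℝ (Fin 3)) ∧
      inner ℝ (q x : EuclideanSpace ℝ (Fin 3)) (p x : EuclideanSpace ℝ (Fin 3)) < 1 ∧
      ∀ i, f i x < inner ℝ (q x : EuclideanSpace ℝ (Fin 3)) (p x : EuclideanSpace ℝ (Fin 3)) := by
  obtain ⟨M, hM, hM1, hM2⟩ := aux_bound k f hf h1
  have hvn : ∀ x, ‖v x‖ ≠ 0 := fun x => norm_ne_zero_iff.2 (hv0 x)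
  have hin : ∀ x, inner ℝ (((1 + M x) / 2) • (p x : EuclideanSpace ℝ (Fin 3)) +
      (√(1 - ((1 + M x) / 2) ^ 2) * ‖v x‖⁻¹) • v x) (p x : EuclideanSpace ℝ (Fin 3))
      = (1 + M x) / 2 := by
    intro x
    rw [inner_add_left, real_inner_smul_left, real_inner_smul_left, hvp, aux_self]; ring
  refine ⟨fun x => ⟨((1 + M x) / 2) • (p x : EuclideanSpace ℝ (Fin 3)) +
      (√(1 - ((1 + M x) / 2) ^ 2) * ‖v x‖⁻¹) • v x, ?_⟩, ?_, ?_⟩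
  · rw [mem_sphere_zero_iff_norm]
    have : ‖((1 + M x) / 2) • (p x : EuclideanSpace ℝ (Fin 3)) +
      (√(1 - ((1 + M x) / 2) ^ 2) * ‖v x‖⁻¹) • v x‖ ^ 2 = 1 := by
      rw [norm_add_sq_real, real_inner_smul_left, real_inner_smul_right, real_inner_comm, hvp,
        norm_smul, norm_smul, aux_norm]
      simp only [Real.norm_eq_abs, mul_pow, sq_abs]
      rw [Real.sq_sqrt (by nlinarith [hM1 x])]
      have := hvn x
      field_simp
      ring
    rw [← abs_of_nonneg (norm_nonneg _), ← Real.sqrt_sq_eq_abs, this, Real.sqrt_one]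
  · refine Continuous.subtype_mk ?_ _
    have h2 : Continuous fun x => ‖v x‖⁻¹ := hv.norm.inv₀ hvn
    fun_prop
  · intro x
    simp only [hin]
    refine ⟨by linarith [hM1 x], by linarith [hM1 x], fun i => by linarith [hM1 x, hM2 i x]⟩

lemma aux_stepS (k : ℕ) (hk : 3 ≤ k) :
    ∃ s : ConfS2 k → ConfS2 (k + 1), Continuous s ∧
      ∀ p, projS2 (k + 1) k (Nat.le_succ k) (s p) = p := by
  obtain ⟨m, rfl⟩ : ∃ m, k = m + 3 := ⟨k - 3, by omega⟩
  have hc : ∀ i, Continuous fun x : ConfS2 (m + 3) => x.1 i := fun i =>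
    (continuous_apply i).comp continuous_subtype_val
  have hc' : ∀ i, Continuous fun x : ConfS2 (m + 3) => (x.1 i : EuclideanSpace ℝ (Fin 3)) :=
    fun i => continuous_subtype_val.comp (hc i)
  have hc0 := hc' 0
  have hc1 := hc' 1
  have hc2 := hc' 2
  obtain ⟨q, hq, hq1⟩ := aux_new (X := ConfS2 (m + 3)) (m + 2)
    (fun i x => inner ℝ (x.1 i.succ : EuclideanSpace ℝ (Fin 3)) (x.1 0 : EuclideanSpace ℝ (Fin 3)))
    (fun i => (hc' _).inner (hc' _)) (fun i x => aux_lt _ _ (x.2 _ _ (Fin.succ_ne_zero i)))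
    (fun x => x.1 0) (hc 0)
    (fun x => (1 - inner ℝ (x.1 1 : EuclideanSpace ℝ (Fin 3)) (x.1 0 : EuclideanSpace ℝ (Fin 3))) •
      ((x.1 2 : EuclideanSpace ℝ (Fin 3)) - (inner ℝ (x.1 2 : EuclideanSpace ℝ (Fin 3)) (x.1 0 : EuclideanSpace ℝ (Fin 3))) • (x.1 0 : EuclideanSpace ℝ (Fin 3)))
      - (1 - inner ℝ (x.1 2 : EuclideanSpace ℝ (Fin 3)) (x.1 0 : EuclideanSpace ℝ (Fin 3))) •
      ((x.1 1 : EuclideanSpace ℝ (Fin 3)) - (inner ℝ (x.1 1 : EuclideanSpace ℝ (Fin 3)) (x.1 0 : EuclideanSpace ℝ (Fin 3))) • (x.1 0 : EuclideanSpace ℝ (Fin 3))))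
    (by fun_prop)
    (by
      intro x hx
      have n0 := aux_self (x.1 0)
      have n1 := aux_self (x.1 1)
      have n2 := aux_self (x.1 2)
      have l1 := aux_lt _ _ (x.2 1 0 (by simp [Fin.ext_iff]))
      have l2 := aux_lt _ _ (x.2 2 0 (by simp [Fin.ext_iff, Nat.mod_eq_of_lt (show 2 < m + 3 by omega)]))
      have n12 : x.1 2 ≠ x.1 1 := x.2 2 1 (by simp [Fin.ext_iff, Nat.mod_eq_of_lt (show 2 < m + 3 by omega)])
      have n12' : (x.1 2 : EuclideanSpace ℝ (Fin 3)) ≠ x.1 1 := fun e => n12 (Subtype.ext e)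
      generalize (x.1 0 : EuclideanSpace ℝ (Fin 3)) = a at *
      generalize (x.1 1 : EuclideanSpace ℝ (Fin 3)) = b at *
      generalize (x.1 2 : EuclideanSpace ℝ (Fin 3)) = c at *
      have key := sub_eq_zero.1 hx
      have k2 := congrArg (fun w => inner ℝ w w) key
      simp only [real_inner_smul_left, real_inner_smul_right, inner_sub_left, inner_sub_right,
        n0, n1, n2, real_inner_comm b a, real_inner_comm c a] at k2
      rw [real_inner_comm a b, real_inner_comm a c] at *
      generalize hs : (inner ℝ a b : ℝ) = s at *
      generalize ht : (inner ℝ a c : ℝ) = t at *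
      have k3 : ((1 - s) * (1 - t)) * (2 * (t - s)) = 0 := by
        linear_combination k2
      have k4 : t = s := by
        have : (1 - s) * (1 - t) ≠ 0 := mul_ne_zero (by linarith) (by linarith)
        have := (mul_eq_zero.1 k3).resolve_left this
        linarith
      subst k4
      have := smul_right_injective _ (show (1 - t) ≠ 0 by linarith) key
      exact n12' (sub_left_injective this))
    (by
      intro x
      simp only [inner_sub_left, real_inner_smul_left, aux_self]
      ring)
  refine ⟨fun x => ⟨Fin.snoc (α := fun _ => TwoSphere) x.1 (q x), ?_⟩, ?_, ?_⟩
  · have hne : ∀ i, q x ≠ x.1 i := by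
      intro i e
      obtain ⟨h0, h1, h2⟩ := hq1 x
      rw [e] at h1 h2
      refine Fin.cases (fun h1 _ => ?_) (fun j _ h2 => lt_irrefl _ (h2 j)) i h1 h2
      rw [aux_self] at h1
      exact lt_irrefl _ h1
    intro i j
    refine Fin.lastCases ?_ (fun i => ?_) i <;> refine Fin.lastCases ?_ (fun j => ?_) j
    · simp
    · intro _; simpa using hne j
    · intro _; simpa using (hne i).symm
    · intro h; simpa using x.2 i j (fun e => h (by rw [e]))
  · refine Continuous.subtype_mk (continuous_pi fun i => ?_) _
    refine Fin.lastCases ?_ (fun i => ?_) i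
    · simpa using hq
    · simpa using hc i
  · intro p
    apply Subtype.ext
    funext i
    exact Fin.snoc_castSucc (α := fun _ => TwoSphere) (q p) p.1 i

lemma aux_abs_lt (x y : TwoSphere) (h : x ≠ y) (h' : x ≠ -y) :
    |inner ℝ (x : EuclideanSpace ℝ (Fin 3)) (y : EuclideanSpace ℝ (Fin 3))| < 1 := by
  rw [abs_lt]
  have h2 := aux_lt x (-y) h'
  rw [show ((-y : TwoSphere) : EuclideanSpace ℝ (Fin 3)) = -(y : EuclideanSpace ℝ (Fin 3)) from rfl,
    inner_neg_right] at h2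
  exact ⟨by linarith, aux_lt x y h⟩

lemma aux_stepP (k : ℕ) (hk : 2 ≤ k) :
    ∃ s : ConfPM k → ConfPM (k + 1), Continuous s ∧
      ∀ p, projPM (k + 1) k (Nat.le_succ k) (s p) = p := by
  obtain ⟨m, rfl⟩ : ∃ m, k = m + 2 := ⟨k - 2, by omega⟩
  have hc : ∀ i, Continuous fun x : ConfPM (m + 2) => x.1 i := fun i =>
    (continuous_apply i).comp continuous_subtype_val
  have hc' : ∀ i, Continuous fun x : ConfPM (m + 2) => (x.1 i : EuclideanSpace ℝ (Fin 3)) :=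
    fun i => continuous_subtype_val.comp (hc i)
  have hc0 := hc' 0
  have hc1 := hc' 1
  obtain ⟨q, hq, hq1⟩ := aux_new (X := ConfPM (m + 2)) (m + 1)
    (fun i x => |inner ℝ (x.1 i.succ : EuclideanSpace ℝ (Fin 3)) (x.1 0 : EuclideanSpace ℝ (Fin 3))|)
    (fun i => ((hc' _).inner (hc' _)).abs)
    (fun i x => aux_abs_lt _ _ (x.2 _ _ (Fin.succ_ne_zero i)).1 (x.2 _ _ (Fin.succ_ne_zero i)).2)
    (fun x => x.1 0) (hc 0)
    (fun x =>
      ((x.1 1 : EuclideanSpace ℝ (Fin 3)) - (inner ℝ (x.1 1 : EuclideanSpace ℝ (Fin 3)) (x.1 0 : EuclideanSpace ℝ (Fin 3))) • (x.1 0 : EuclideanSpace ℝ (Fin 3))))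
    (by fun_prop)
    (by
      intro x hx
      have n0 := aux_self (x.1 0)
      have n1 := aux_self (x.1 1)
      have h10 := x.2 1 0 (by simp [Fin.ext_iff])
      have l1 := aux_abs_lt _ _ h10.1 h10.2
      have k2 := congrArg (fun w => inner ℝ w (x.1 1 : EuclideanSpace ℝ (Fin 3))) hx
      simp only [real_inner_smul_left, inner_sub_left, n1, inner_zero_left] at k2
      rw [real_inner_comm] at l1
      rw [real_inner_comm] at k2
      rw [← sq_lt_one_iff_abs_lt_one] at l1
      nlinarith)
    (by
      intro x
      simp only [inner_sub_left, real_inner_smul_left, aux_self]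
      ring)
  refine ⟨fun x => ⟨Fin.snoc (α := fun _ => TwoSphere) x.1 (q x), ?_⟩, ?_, ?_⟩
  · have hne : ∀ i, q x ≠ x.1 i ∧ q x ≠ - x.1 i := by
      intro i
      obtain ⟨h0, h1, h2⟩ := hq1 x
      constructor
      · intro e
        rw [e] at h1 h2
        refine Fin.cases (fun h1 _ => ?_) (fun j _ h2 => ?_) i h1 h2
        · rw [aux_self] at h1
          exact lt_irrefl _ h1
        · exact absurd (h2 j) (not_lt.2 (le_abs_self _))
      · intro e
        rw [e, show ((-x.1 i : TwoSphere) : EuclideanSpace ℝ (Fin 3)) =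
          -(x.1 i : EuclideanSpace ℝ (Fin 3)) from rfl, inner_neg_left] at h0 h2
        refine Fin.cases (fun h0 _ => ?_) (fun j _ h2 => ?_) i h0 h2
        · rw [aux_self] at h0
          linarith
        · exact absurd (h2 j) (not_lt.2 (neg_le_abs _))
    intro i j
    refine Fin.lastCases ?_ (fun i => ?_) i <;> refine Fin.lastCases ?_ (fun j => ?_) j
    · simp
    · intro _; simpa using hne j
    · intro _
      have h := hne i
      simp only [Fin.snoc_castSucc, Fin.snoc_last]
      exact ⟨h.1.symm, fun e => h.2 (by rw [e, neg_neg])⟩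
    · intro h; simpa using x.2 i j (fun e => h (by rw [e]))
  · refine Continuous.subtype_mk (continuous_pi fun i => ?_) _
    refine Fin.lastCases ?_ (fun i => ?_) i
    · simpa using hq
    · simpa using hc i
  · intro p
    apply Subtype.ext
    funext i
    exact Fin.snoc_castSucc (α := fun _ => TwoSphere) (q p) p.1 i

/-- Cross-sections of projections of (orbit) configuration spaces of the
2-sphere onto initial coordinates exist: (i) for `n ≥ k ≥ 3` for `C_n(S²)`,
(ii) for the projection `C₂(S²) → C₁(S²) = S²`, and (iii) for `n ≥ k ≥ 2` for
the antipodal orbit configuration spaces `C_n^±(S²)`. -/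
theorem stmt_17 :
    (∀ n k : ℕ, 3 ≤ k → ∀ h : k ≤ n,
      ∃ s : ConfS2 k → ConfS2 n, Continuous s ∧ ∀ p, projS2 n k h (s p) = p) ∧
    (∃ s : ConfS2 1 → ConfS2 2,
      Continuous s ∧ ∀ p, projS2 2 1 (by norm_num) (s p) = p) ∧
    (∀ n k : ℕ, 2 ≤ k → ∀ h : k ≤ n,
      ∃ s : ConfPM k → ConfPM n, Continuous s ∧ ∀ p, projPM n k h (s p) = p) := by
  refine ⟨?_, ?_, ?_⟩
  · intro n k hk h
    induction n, h using Nat.le_induction with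
    | base => exact ⟨id, continuous_id, fun p => rfl⟩
    | succ n hn ih =>
      obtain ⟨s, hs, hs1⟩ := ih
      obtain ⟨t, ht, ht1⟩ := aux_stepS n (hk.trans hn)
      refine ⟨t ∘ s, ht.comp hs, fun p => ?_⟩
      refine Eq.trans ?_ (hs1 p)
      exact congrArg (projS2 n k hn) (ht1 (s p))
  · refine ⟨fun p => ⟨![p.1 0, -p.1 0], ?_⟩, ?_, ?_⟩
    · have h : p.1 0 ≠ - p.1 0 := by
        intro e
        have := aux_self (p.1 0)
        have e' := congrArg (fun y : TwoSphere =>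
          inner ℝ (y : EuclideanSpace ℝ (Fin 3)) (p.1 0 : EuclideanSpace ℝ (Fin 3))) e
        simp only [show ((-p.1 0 : TwoSphere) : EuclideanSpace ℝ (Fin 3)) =
          -(p.1 0 : EuclideanSpace ℝ (Fin 3)) from rfl, inner_neg_left, this] at e'
        norm_num at e'
      intro i j hij
      fin_cases i <;> fin_cases j
      · exact absurd rfl hij
      · exact h
      · exact h.symm
      · exact absurd rfl hij
    · have h0 : Continuous fun p : ConfS2 1 => p.1 0 :=
        (continuous_apply 0).comp continuous_subtype_val
      refine Continuous.subtype_mk (continuous_pi fun i => ?_) _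
      fin_cases i
      · exact h0
      · exact Continuous.subtype_mk (continuous_subtype_val.comp h0).neg _
    · intro p
      apply Subtype.ext
      funext i
      fin_cases i
      rfl
  · intro n k hk h
    induction n, h using Nat.le_induction with
    | base => exact ⟨id, continuous_id, fun p => rfl⟩
    | succ n hn ih =>
      obtain ⟨s, hs, hs1⟩ := ih
      obtain ⟨t, ht, ht1⟩ := aux_stepP n (hk.trans hn)
      refine ⟨t ∘ s, ht.comp hs, fun p => ?_⟩
      refine Eq.trans ?_ (hs1 p)
      exact congrArg (projPM n k hn) (ht1 (s p))
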